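/- Let X be a separable Banach space over ℝ or ℂ and T : X → X a bounded linear operator that is chain transitive and has the positive shadowing property. Then T is frequently hypercyclic: there exists z ∈ X such that for every non-empty open set V ⊆ X the set {n ∈ ℕ : T^n z ∈ V} has positive lower density. -/

import Mathlib

/-- An `ε`-chain of `T` from `x` to `y`: a finite sequence `x = c 0, c 1, …, c n = y`
with `n ≥ 1` such that `‖T (c i) - c (i+1)‖ < ε` for every `0 ≤ i < n`. -/
def EpsChain {E : Type*} [NormedAddCommGroup E] (T : E → E) (ε : ℝ) (x y : E) : Prop :=
  ∃ (n : ℕ) (c : ℕ → E), 1 ≤ n ∧ c 0 = x ∧ c n = y ∧ ∀ i < n, ‖T (c i) - c (i + 1)‖ < ε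

/-- `x` is a chain recurrent point of `T` if for every `ε > 0` there is an `ε`-chain
beginning and ending at `x`. -/
def ChainRecurrent {E : Type*} [NormedAddCommGroup E] (T : E → E) (x : E) : Prop :=
  ∀ ε > 0, EpsChain T ε x x

/-- `T` has the positive shadowing property: for every `ε > 0` there is `δ > 0` such
that every positive `δ`-pseudo orbit `(x n)` (i.e. `‖T (x n) - x (n+1)‖ ≤ δ` for all `n`)
is `ε`-shadowed by some `z`, i.e. `‖x n - T^[n] z‖ < ε` for all `n`. -/
def PosShadowing {E : Type*} [NormedAddCommGroup E] (T : E → E) : Prop :=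
  ∀ ε > 0, ∃ δ > 0, ∀ x : ℕ → E, (∀ n : ℕ, ‖T (x n) - x (n + 1)‖ ≤ δ) →
    ∃ z : E, ∀ n : ℕ, ‖x n - T^[n] z‖ < ε

/-- The lower density of a set `A ⊆ ℕ`: `liminf_{N → ∞} #(A ∩ [1, N]) / N`. -/
noncomputable def lowerDensity (A : Set ℕ) : ℝ :=
  Filter.liminf (fun N : ℕ => ((A ∩ Set.Icc 1 N).ncard : ℝ) / N) Filter.atTop

open Filter Topology

section Density

/-- The number of `n ∈ [1, M]` lying in an `L`-block whose index is `-1` modulo `P` is at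
most `2 * M / P`. -/
lemma card_filter_dvd_div_add_one_mul_le {P L : ℕ} (hP : 2 ≤ P) (hL : 0 < L) (M : ℕ) :
    ((Finset.Icc 1 M).filter (fun n => P ∣ n / L + 1)).card * P ≤ 2 * M := by
  have hsub : (Finset.Icc 1 M).filter (fun n => P ∣ n / L + 1) ⊆
      (Finset.range ((M + L) / (P * L)) ×ˢ Finset.range L).image
        (fun p => (P * (p.1 + 1) - 1) * L + p.2) := by
    intro n hn
    obtain ⟨hn, k, hk⟩ := Finset.mem_filter.1 hn
    obtain ⟨-, hnM⟩ := Finset.mem_Icc.1 hn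
    have hdiv := Nat.div_add_mod n L
    obtain ⟨k, rfl⟩ : ∃ k', k = k' + 1 := by
      refine Nat.exists_eq_succ_of_ne_zero ?_
      rintro rfl
      simp at hk
    refine Finset.mem_image.2 ⟨(k, n % L), ?_, ?_⟩
    · refine Finset.mem_product.2 ⟨Finset.mem_range.2 ?_, Finset.mem_range.2 (Nat.mod_lt _ hL)⟩
      refine (Nat.le_div_iff_mul_le (by positivity)).2 ?_
      calc (k + 1) * (P * L) = (P * (k + 1)) * L := by ring
        _ = L * (n / L) + L := by rw [← hk]; ring
        _ ≤ M + L := by omega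
    · simp only [← hk, Nat.add_sub_cancel]
      rw [mul_comm]
      exact hdiv
  have hcard := (Finset.card_le_card hsub).trans Finset.card_image_le
  rw [Finset.card_product, Finset.card_range, Finset.card_range] at hcard
  have hmul : (M + L) / (P * L) * L * P ≤ 2 * M := by
    rcases Nat.eq_zero_or_pos ((M + L) / (P * L)) with h | h
    · simp [h]
    · have h1 : P * L ≤ M + L := by
        by_contra hlt
        rw [Nat.div_eq_of_lt (by omega)] at h
        exact lt_irrefl _ h
      have h2 : 2 * L ≤ P * L := Nat.mul_le_mul_right L hP
      have h3 := Nat.div_mul_le_self (M + L) (P * L)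
      calc (M + L) / (P * L) * L * P = (M + L) / (P * L) * (P * L) := by ring
        _ ≤ 2 * M := by omega
  exact (Nat.mul_le_mul_right P hcard).trans hmul

open Classical in
lemma sub_div_le_card_filter_progression {N : ℕ} (hN : 0 < N) (t M : ℕ) :
    (M - t) / N ≤ ((Finset.Icc 1 M).filter (fun n => ∃ k, n = t + k * N)).card := by
  have hinj : Function.Injective (fun k => t + (k + 1) * N) := by
    intro a b hab
    have : (a + 1) * N = (b + 1) * N := by simpa using hab
    have := Nat.eq_of_mul_eq_mul_right hN this
    omega
  calc (M - t) / N = ((Finset.range ((M - t) / N)).image (fun k => t + (k + 1) * N)).card := by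
        rw [Finset.card_image_of_injective _ hinj, Finset.card_range]
    _ ≤ _ := by
        refine Finset.card_le_card fun n hn => ?_
        obtain ⟨k, hk, rfl⟩ := Finset.mem_image.1 hn
        have h1 : (k + 1) * N ≤ M - t :=
          (Nat.le_div_iff_mul_le hN).1 (Finset.mem_range.1 hk)
        have h2 : 0 < (k + 1) * N := by positivity
        exact Finset.mem_filter.2 ⟨Finset.mem_Icc.2 ⟨by omega, by omega⟩, k + 1, rfl⟩

open Classical in
/-- An arithmetic progression of difference `N`, deprived of countably many sets of blocks of
summably small density, has positive lower density. -/
lemma lowerDensity_pos_of_progression_diff {N : ℕ} (hN : 0 < N) (t : ℕ) {P L : ℕ → ℕ}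
    (hP : ∀ i, 8 * 2 ^ (i + 1) * N ≤ P i) (hL : ∀ i, 0 < L i) {A : Set ℕ}
    (hA : ∀ n, (∃ k, n = t + k * N) → (∀ i, ¬ P i ∣ n / L i + 1) → n ∈ A) :
    0 < lowerDensity A := by
  have hN' : (0 : ℝ) < N := by exact_mod_cast hN
  have hP2 : ∀ i, 2 ^ (i + 1) * 8 ≤ P i := fun i => by
    nlinarith [hP i, Nat.one_le_two_pow (n := i + 1)]
  have hbad : ∀ M i : ℕ,
      (((Finset.Icc 1 M).filter (fun n => P i ∣ n / L i + 1)).card : ℝ)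
        ≤ (M / (4 * N)) * (1 / 2) ^ (i + 1) := by
    intro M i
    have h := card_filter_dvd_div_add_one_mul_le (P := P i) (L := L i)
      (by have := hP2 i; have := Nat.one_le_two_pow (n := i + 1); omega) (hL i) M
    have h' : (((Finset.Icc 1 M).filter (fun n => P i ∣ n / L i + 1)).card : ℝ) * P i
        ≤ 2 * M := by exact_mod_cast h
    have hPi : (8 * 2 ^ (i + 1) * N : ℝ) ≤ P i := by exact_mod_cast hP i
    have h8 : (((Finset.Icc 1 M).filter (fun n => P i ∣ n / L i + 1)).card : ℝ)
        * (8 * 2 ^ (i + 1) * N) ≤ 2 * M :=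
      (mul_le_mul_of_nonneg_left hPi (Nat.cast_nonneg _)).trans h'
    rw [← le_div_iff₀ (by positivity)] at h8
    refine h8.trans (le_of_eq ?_)
    rw [div_pow, one_pow]
    field_simp
    ring
  have hcount : ∀ M : ℕ, (M : ℝ) / N - t / N - 1 - M / (4 * N) ≤
      ((A ∩ Set.Icc 1 M).ncard : ℝ) := by
    intro M
    have hsub : (Finset.Icc 1 M).filter (fun n => ∃ k, n = t + k * N) ⊆
        ((A ∩ Set.Icc 1 M).toFinite.toFinset) ∪
          (Finset.range (M + 1)).biUnion
            (fun i => (Finset.Icc 1 M).filter (fun n => P i ∣ n / L i + 1)) := by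
      intro n hn
      obtain ⟨hnM, hk⟩ := Finset.mem_filter.1 hn
      by_cases hE : ∀ i, ¬ P i ∣ n / L i + 1
      · refine Finset.mem_union_left _ ?_
        simpa using ⟨hA n hk hE, by simpa using hnM⟩
      · push Not at hE
        obtain ⟨i, hi⟩ := hE
        refine Finset.mem_union_right _ (Finset.mem_biUnion.2 ⟨i, ?_, ?_⟩)
        · have h1 := Nat.le_of_dvd (Nat.succ_pos _) hi
          have h2 := Nat.div_le_self n (L i)
          have h3 := hP2 i
          have h4 := Nat.lt_two_pow_self (n := i + 1)
          have h5 := (Finset.mem_Icc.1 hnM).2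
          refine Finset.mem_range.2 ?_
          omega
        · exact Finset.mem_filter.2 ⟨hnM, hi⟩
    have hle := (Finset.card_le_card hsub).trans (Finset.card_union_le _ _)
    rw [← Set.ncard_eq_toFinset_card _] at hle
    have hle1 := (sub_div_le_card_filter_progression hN t M).trans hle
    have hle2 : ((((M - t) / N : ℕ)) : ℝ) ≤ ((A ∩ Set.Icc 1 M).ncard : ℝ) +
        ∑ i ∈ Finset.range (M + 1),
          (((Finset.Icc 1 M).filter (fun n => P i ∣ n / L i + 1)).card : ℝ) := by
      exact_mod_cast hle1.trans (Nat.add_le_add_left Finset.card_biUnion_le _)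
    have hsum : ∑ i ∈ Finset.range (M + 1),
        (((Finset.Icc 1 M).filter (fun n => P i ∣ n / L i + 1)).card : ℝ) ≤ M / (4 * N) := by
      refine (Finset.sum_le_sum fun i _ => hbad M i).trans ?_
      rw [← Finset.mul_sum]
      refine mul_le_of_le_one_right (by positivity) ?_
      have hgeom := sum_geometric_two_le (M + 1)
      simp only [pow_succ, ← Finset.sum_mul]
      linarith
    have hfloor : (M : ℝ) / N - t / N - 1 ≤ (((M - t) / N : ℕ) : ℝ) := by
      have h1 : M < t + (((M - t) / N) + 1) * N := by
        have := Nat.lt_div_mul_add (a := M - t) hN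
        have h2 : ((M - t) / N + 1) * N = (M - t) / N * N + N := by ring
        omega
      have h2 : (M : ℝ) < t + ((((M - t) / N : ℕ) : ℝ) + 1) * N := by exact_mod_cast h1
      rw [← sub_div, sub_le_iff_le_add, div_le_iff₀ hN']
      linarith
    linarith
  have hlow : ∀ᶠ M : ℕ in atTop, 1 / (4 * N : ℝ) ≤ ((A ∩ Set.Icc 1 M).ncard : ℝ) / M := by
    filter_upwards [eventually_ge_atTop (2 * (t + N))] with M hM
    have hM' : (2 * (t + N) : ℝ) ≤ M := by exact_mod_cast hM
    have hMpos : (0 : ℝ) < M := by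
      have : (0 : ℝ) ≤ t := Nat.cast_nonneg t
      linarith
    rw [le_div_iff₀ hMpos]
    refine le_trans ?_ (hcount M)
    have : (M : ℝ) / N - t / N - 1 - M / (4 * N) - 1 / (4 * N) * M = (M / 2 - t - N) / N := by
      field_simp
      ring
    have h0 : 0 ≤ (M / 2 - t - N : ℝ) / N := div_nonneg (by linarith) hN'.le
    linarith
  refine lt_of_lt_of_le (by positivity : (0 : ℝ) < 1 / (4 * N)) ?_
  refine le_liminf_of_le ?_ hlow
  refine IsBoundedUnder.isCoboundedUnder_ge (isBoundedUnder_of ⟨1, fun M => ?_⟩)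
  refine div_le_one_of_le₀ ?_ (Nat.cast_nonneg _)
  have : (A ∩ Set.Icc 1 M).ncard ≤ (Set.Icc 1 M).ncard :=
    Set.ncard_le_ncard Set.inter_subset_right (Set.finite_Icc 1 M)
  rw [← Finset.coe_Icc, Set.ncard_coe_finset] at this
  exact_mod_cast (by simpa using this)

end Density

section Chains

lemma mod_add_one_cases {N : ℕ} (hN : 0 < N) (n : ℕ) :
    (n % N + 1 = N ∧ (n + 1) % N = 0) ∨ (n + 1) % N = n % N + 1 := by
  rcases (Nat.succ_le_of_lt (Nat.mod_lt n hN)).eq_or_lt with h | h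
  · refine Or.inl ⟨h, ?_⟩
    rw [← Nat.mod_add_mod, ← Nat.succ_eq_add_one, h, Nat.mod_self]
  · exact Or.inr (by rw [← Nat.mod_add_mod, Nat.mod_eq_of_lt h])

variable {E : Type*} [NormedAddCommGroup E] {T : E → E} {ε : ℝ}

lemma EpsChain.trans {x y z : E} (h₁ : EpsChain T ε x y) (h₂ : EpsChain T ε y z) :
    ∃ (n k : ℕ) (c : ℕ → E), k < n ∧ c 0 = x ∧ c k = y ∧ c n = z ∧
      ∀ i < n, ‖T (c i) - c (i + 1)‖ < ε := by
  obtain ⟨m, c, hm, hc0, hcm, hc⟩ := h₁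
  obtain ⟨n, d, hn, hd0, hdn, hd⟩ := h₂
  refine ⟨m + n, m, fun i => if i < m then c i else d (i - m), by omega, ?_, ?_, ?_, ?_⟩
  · simp [hc0, show 0 < m by omega]
  · simp [hd0]
  · simp [hdn]
  · intro i hi
    rcases lt_trichotomy (i + 1) m with h | h | h
    · simpa [h, show i < m by omega] using hc i (by omega)
    · have := hc i (by omega)
      rw [h, hcm] at this
      simpa [show i < m by omega, h, hd0] using this
    · have := hd (i - m) (by omega)
      simpa [show ¬ i < m by omega, show ¬ i + 1 < m by omega,
        show i + 1 - m = i - m + 1 by omega] using this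

/-- The right endpoint of a chain can be moved slightly. -/
lemma EpsChain.eventually_right {x y : E} (h : EpsChain T ε x y) :
    ∀ᶠ y' in 𝓝 y, EpsChain T ε x y' := by
  obtain ⟨n, c, hn, hc0, hcn, hc⟩ := h
  obtain ⟨n, rfl⟩ : ∃ k, n = k + 1 := ⟨n - 1, by omega⟩
  have hlt : ‖T (c n) - y‖ < ε := hcn ▸ hc n (by omega)
  have hcont : Continuous fun y' => ‖T (c n) - y'‖ := by fun_prop
  filter_upwards [hcont.continuousAt.eventually_lt_const hlt] with y' hy'
  refine ⟨n + 1, Function.update c (n + 1) y', hn, ?_, by simp, fun i hi => ?_⟩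
  · rw [Function.update_of_ne (by omega), hc0]
  · rw [Function.update_of_ne (by omega)]
    rcases Nat.lt_succ_iff_lt_or_eq.1 hi with h | rfl
    · rw [Function.update_of_ne (by omega)]
      exact hc i hi
    · simpa using hy'

/-- The left endpoint of a chain can be moved slightly. -/
lemma EpsChain.eventually_left (hT : Continuous T) {x y : E} (h : EpsChain T ε x y) :
    ∀ᶠ x' in 𝓝 x, EpsChain T ε x' y := by
  obtain ⟨n, c, hn, hc0, hcn, hc⟩ := h
  have hlt : ‖T x - c 1‖ < ε := hc0 ▸ hc 0 (by omega)
  have hcont : Continuous fun x' => ‖T x' - c 1‖ := by fun_prop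
  filter_upwards [hcont.continuousAt.eventually_lt_const hlt] with x' hx'
  refine ⟨n, Function.update c 0 x', hn, by simp, ?_, fun i hi => ?_⟩
  · rw [Function.update_of_ne (by omega), hcn]
  · rw [Function.update_of_ne (by omega : i + 1 ≠ 0)]
    rcases Nat.eq_zero_or_pos i with rfl | h
    · simpa using hx'
    · rw [Function.update_of_ne (by omega)]
      exact hc i hi

/-- On a connected space, chain recurrence of all points implies that any two points are joined
by chains. -/
lemma epsChain_of_forall_chainRecurrent [PreconnectedSpace E] (hT : Continuous T)
    (hct : ∀ x, ChainRecurrent T x) (hε : 0 < ε) (x y : E) : EpsChain T ε x y := by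
  have hclopen : IsClopen {y | EpsChain T ε x y} := by
    refine ⟨isClosed_of_closure_subset fun y hy => ?_,
      isOpen_iff_mem_nhds.2 fun y hy => EpsChain.eventually_right hy⟩
    obtain ⟨y', hy'y, hxy'⟩ :=
      mem_closure_iff_nhds.1 hy _ ((hct y ε hε).eventually_left hT)
    obtain ⟨n, k, c, hkn, h0, -, h1, hc⟩ := EpsChain.trans hxy' hy'y
    exact ⟨n, c, by omega, h0, h1, hc⟩
  have huniv := hclopen.eq_univ ⟨x, hct x ε hε⟩
  exact (huniv ▸ Set.mem_univ y : y ∈ {y | EpsChain T ε x y})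

end Chains

section Shadowing

variable {𝕜 : Type*} [RCLike 𝕜] {X : Type*} [NormedAddCommGroup X] [NormedSpace 𝕜 X]
  {T : X →L[𝕜] X}

/-- For linear maps the shadowing constant is linear in the size of the errors. -/
lemma PosShadowing.exists_linear_bound (hsh : PosShadowing (⇑T)) :
    ∃ K > 0, ∀ η > 0, ∀ x : ℕ → X, (∀ n, ‖T (x n) - x (n + 1)‖ ≤ η) →
      ∃ z, ∀ n, ‖x n - (⇑T)^[n] z‖ ≤ K * η := by
  obtain ⟨δ, hδ, h⟩ := hsh 1 one_pos
  refine ⟨1 / δ, by positivity, fun η hη x hx => ?_⟩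
  have hr : 0 < δ / η := by positivity
  have hnorm : ‖((δ / η : ℝ) : 𝕜)‖ = δ / η := by rw [RCLike.norm_ofReal, abs_of_pos hr]
  have hne : ((δ / η : ℝ) : 𝕜) ≠ 0 := by
    rw [← norm_pos_iff, hnorm]
    exact hr
  obtain ⟨z, hz⟩ := h (fun n => ((δ / η : ℝ) : 𝕜) • x n) fun n => by
    rw [map_smul, ← smul_sub, norm_smul, hnorm]
    calc δ / η * ‖T (x n) - x (n + 1)‖ ≤ δ / η * η := by gcongr; exact hx n
      _ = δ := by field_simp
  refine ⟨((δ / η : ℝ) : 𝕜)⁻¹ • z, fun n => ?_⟩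
  have hzn : ((δ / η : ℝ) : 𝕜) • x n - (⇑T)^[n] z =
      ((δ / η : ℝ) : 𝕜) • (x n - (⇑T)^[n] (((δ / η : ℝ) : 𝕜)⁻¹ • z)) := by
    rw [smul_sub, ← FunLike.coe_pow_eq_iterate, map_smul, smul_inv_smul₀ hne]
  have := (hz n).le
  rw [hzn, norm_smul, hnorm, ← le_div_iff₀' hr] at this
  refine this.trans (le_of_eq ?_)
  field_simp

/-- A vector shadowing a periodic sequence can be averaged into an almost periodic one. -/
lemma exists_almost_periodic_of_shadow {N : ℕ} {x : ℕ → X} (hx : ∀ n, x (n + N) = x n)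
    {C : ℝ} {z : X} (hz : ∀ n, ‖x n - (⇑T)^[n] z‖ ≤ C) {η : ℝ} (hη : 0 < η) :
    ∃ a, (∀ n, ‖x n - (⇑T)^[n] a‖ ≤ C) ∧ ‖(⇑T)^[N] a - a‖ ≤ η := by
  obtain ⟨J, hJ⟩ := exists_nat_gt (2 * C / η)
  have hC : 0 ≤ C := (norm_nonneg _).trans (hz 0)
  have hJ0 : (0 : ℝ) < J := lt_of_le_of_lt (by positivity) hJ
  have hJ𝕜 : (J : 𝕜) ≠ 0 := by
    have : J ≠ 0 := by rintro rfl; simp at hJ0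
    exact_mod_cast this
  have hxk : ∀ k n, x (n + k * N) = x n := by
    intro k n
    induction k with
    | zero => simp
    | succ k ih => rw [Nat.succ_mul, ← add_assoc, hx, ih]
  have hiter : ∀ n, (⇑T)^[n] ((J : 𝕜)⁻¹ • ∑ k ∈ Finset.range J, (⇑T)^[k * N] z) =
      (J : 𝕜)⁻¹ • ∑ k ∈ Finset.range J, (⇑T)^[n + k * N] z := by
    intro n
    rw [← FunLike.coe_pow_eq_iterate, map_smul, map_sum]
    simp only [FunLike.coe_pow_eq_iterate, Function.iterate_add_apply]
  refine ⟨(J : 𝕜)⁻¹ • ∑ k ∈ Finset.range J, (⇑T)^[k * N] z, fun n => ?_, ?_⟩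
  · have hxn : x n = (J : 𝕜)⁻¹ • ∑ k ∈ Finset.range J, x (n + k * N) := by
      simp only [hxk, Finset.sum_const, Finset.card_range]
      rw [← Nat.cast_smul_eq_nsmul 𝕜, inv_smul_smul₀ hJ𝕜]
    rw [hiter, hxn, ← smul_sub, ← Finset.sum_sub_distrib, norm_smul, norm_inv, RCLike.norm_natCast,
      inv_mul_le_iff₀ hJ0]
    refine (norm_sum_le_of_le _ fun k _ => hz (n + k * N)).trans (le_of_eq ?_)
    simp
  · have htel : (⇑T)^[N] ((J : 𝕜)⁻¹ • ∑ k ∈ Finset.range J, (⇑T)^[k * N] z) -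
        (J : 𝕜)⁻¹ • ∑ k ∈ Finset.range J, (⇑T)^[k * N] z =
        (J : 𝕜)⁻¹ • ((⇑T)^[J * N] z - z) := by
      rw [hiter, ← smul_sub, ← Finset.sum_sub_distrib]
      have := Finset.sum_range_sub (fun k => (⇑T)^[k * N] z) J
      simp only [Nat.succ_mul, zero_mul, Function.iterate_zero, id] at this
      rw [← this]
      simp only [add_comm]
    rw [htel, norm_smul, norm_inv, RCLike.norm_natCast, inv_mul_le_iff₀ hJ0]
    have h1 : ‖x 0 - (⇑T)^[J * N] z‖ ≤ C := by
      have := hz (0 + J * N)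
      rwa [hxk, zero_add] at this
    have h2 : ‖x 0 - z‖ ≤ C := hz 0
    have h3 : (⇑T)^[J * N] z - z = (x 0 - z) - (x 0 - (⇑T)^[J * N] z) := by abel
    rw [h3]
    refine (norm_sub_le _ _).trans ?_
    rw [div_lt_iff₀ hη] at hJ
    linarith

/-- Periodic shadowing: a periodic pseudo-orbit is shadowed by a periodic vector of the same
period. -/
lemma PosShadowing.exists_periodic [CompleteSpace X] (hsh : PosShadowing (⇑T)) {ε : ℝ}
    (hε : 0 < ε) :
    ∃ δ > 0, ∀ N > 0, ∀ x : ℕ → X, (∀ n, x (n + N) = x n) →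
      (∀ n, ‖T (x n) - x (n + 1)‖ ≤ δ) →
      ∃ z, (⇑T)^[N] z = z ∧ ∀ n, ‖x n - (⇑T)^[n] z‖ ≤ ε := by
  obtain ⟨K, hK, hsh⟩ := hsh.exists_linear_bound
  refine ⟨ε / (3 * K), by positivity, fun N hN x hxN hx => ?_⟩
  set δ := ε / (3 * K) with hδdef
  have hδ : 0 < δ := by positivity
  have hKδ : K * δ = ε / 3 := by rw [hδdef]; field_simp
  have himprove : ∀ (i : ℕ) (a : {a : X // ‖(⇑T)^[N] a - a‖ ≤ δ / 2 ^ i}),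
      ∃ a' : {a : X // ‖(⇑T)^[N] a - a‖ ≤ δ / 2 ^ (i + 1)},
        ∀ n < N, ‖(⇑T)^[n] a.1 - (⇑T)^[n] a'.1‖ ≤ K * (δ / 2 ^ i) := by
    rintro i ⟨a, ha⟩
    obtain ⟨z, hz⟩ := hsh (δ / 2 ^ i) (by positivity) (fun n => (⇑T)^[n % N] a) fun n => by
      have hlt := Nat.mod_lt n hN
      rw [← Function.iterate_succ_apply' (⇑T)]
      rcases mod_add_one_cases hN n with ⟨h, h'⟩ | h'
      · rw [h', Nat.succ_eq_add_one, h]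
        exact ha
      · rw [h', sub_self, norm_zero]
        positivity
    obtain ⟨a', ha', hper⟩ := exists_almost_periodic_of_shadow
      (fun n => by rw [Nat.add_mod_right]) hz (show 0 < δ / 2 ^ (i + 1) by positivity)
    refine ⟨⟨a', hper⟩, fun n hn => ?_⟩
    have := ha' n
    rwa [Nat.mod_eq_of_lt hn] at this
  choose F hF using himprove
  obtain ⟨z, hz⟩ := hsh δ hδ x hx
  obtain ⟨a₀, ha₀, hper⟩ := exists_almost_periodic_of_shadow hxN hz hδ
  let a : (i : ℕ) → {a : X // ‖(⇑T)^[N] a - a‖ ≤ δ / 2 ^ i} := fun i =>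
    Nat.rec ⟨a₀, by simpa using hper⟩ (fun i s => F i s) i
  have hdist : ∀ n < N, ∀ i,
      dist ((⇑T)^[n] (a i).1) ((⇑T)^[n] (a (i + 1)).1) ≤ (2 * (K * δ)) / 2 / 2 ^ i := by
    intro n hn i
    rw [dist_eq_norm]
    refine (hF i (a i) n hn).trans (le_of_eq ?_)
    ring
  have hcauchy : CauchySeq fun i => (a i).1 := cauchySeq_of_le_geometric_two (hdist 0 hN)
  obtain ⟨b, hb⟩ := cauchySeq_tendsto_of_complete hcauchy
  have hTb : ∀ n, Tendsto (fun i => (⇑T)^[n] (a i).1) atTop (𝓝 ((⇑T)^[n] b)) := fun n =>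
    ((T.continuous.iterate n).tendsto b).comp hb
  have hbper : (⇑T)^[N] b = b := by
    have h1 : Tendsto (fun i => ‖(⇑T)^[N] (a i).1 - (a i).1‖) atTop (𝓝 ‖(⇑T)^[N] b - b‖) :=
      ((hTb N).sub hb).norm
    have h2 : Tendsto (fun i => δ / 2 ^ i) atTop (𝓝 0) := by
      have := (tendsto_pow_atTop_nhds_zero_of_lt_one (r := (1 / 2 : ℝ)) (by norm_num)
        (by norm_num)).const_mul δ
      simpa [div_eq_mul_inv] using this
    have h3 : ‖(⇑T)^[N] b - b‖ ≤ 0 := le_of_tendsto_of_tendsto' h1 h2 fun i => (a i).2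
    exact sub_eq_zero.1 (norm_le_zero_iff.1 h3)
  refine ⟨b, hbper, fun n => ?_⟩
  have hmod : ‖x (n % N) - (⇑T)^[n % N] b‖ ≤ ε := by
    have h1 : dist ((⇑T)^[n % N] a₀) ((⇑T)^[n % N] b) ≤ 2 * (K * δ) :=
      dist_le_of_le_geometric_two_of_tendsto₀ (hdist _ (Nat.mod_lt n hN)) (hTb _)
    have h2 := ha₀ (n % N)
    rw [dist_eq_norm] at h1
    have h3 := norm_sub_le_norm_sub_add_norm_sub (x (n % N)) ((⇑T)^[n % N] a₀) ((⇑T)^[n % N] b)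
    linarith
  have hxmod : x (n % N) = x n := Function.Periodic.map_mod_nat hxN n
  have hbmod : (⇑T)^[n % N] b = (⇑T)^[n] b := Function.IsPeriodicPt.iterate_mod_apply hbper n
  rwa [hxmod, hbmod] at hmod

/-- A periodic vector `w` can be perturbed into a periodic vector `w'` that visits a neighbourhood
of `y` periodically, and whose orbit stays close to that of `w` outside one `L`-block out of `P`. -/
lemma exists_periodic_visiting [CompleteSpace X] (hct : ∀ x : X, ChainRecurrent (⇑T) x)
    (hsh : PosShadowing (⇑T)) {w : X} {N : ℕ} (hN : 0 < N) (hw : (⇑T)^[N] w = w) (y : X)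
    {ε : ℝ} (hε : 0 < ε) {P : ℕ} (hP : 2 ≤ P) :
    ∃ (w' : X) (L t : ℕ), 0 < L ∧ N ∣ L ∧ (⇑T)^[P * L] w' = w' ∧
      (∀ n, ¬ P ∣ n / L + 1 → ‖(⇑T)^[n] w - (⇑T)^[n] w'‖ ≤ ε) ∧
      ∀ k, ‖y - (⇑T)^[t + k * (P * L)] w'‖ ≤ ε := by
  obtain ⟨δ, hδ, hsh⟩ := hsh.exists_periodic hε
  have : PreconnectedSpace X := by
    let _ : NormedSpace ℝ X := NormedSpace.restrictScalars ℝ 𝕜 X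
    infer_instance
  obtain ⟨m, j, c, hjm, hc0, hcj, hcm, hc⟩ := EpsChain.trans
    (epsChain_of_forall_chainRecurrent T.continuous hct hδ w y)
    (epsChain_of_forall_chainRecurrent T.continuous hct hδ y w)
  have hm : 0 < m := by omega
  have hL : 0 < m * N := Nat.mul_pos hm hN
  have hwper : ∀ k, Function.IsPeriodicPt (⇑T) (k * N) w := fun k =>
    Function.IsPeriodicPt.const_mul hw k
  have hiter : ∀ n, (⇑T)^[n + P * (m * N)] w = (⇑T)^[n] w := fun n => by
    rw [Function.iterate_add_apply, ← mul_assoc, (hwper (P * m)).eq]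
  have hloop : ∀ n, ‖T (c (n % m)) - c ((n + 1) % m)‖ ≤ δ := fun n => by
    have hn := (hc (n % m) (Nat.mod_lt n hm)).le
    rcases mod_add_one_cases hm n with ⟨h, h'⟩ | h'
    · rwa [h, hcm, ← hc0, ← h'] at hn
    · rwa [← h'] at hn
  have hswitch : ∀ n, m * N ∣ n → c (n % m) = (⇑T)^[n] w := by
    rintro n ⟨k, rfl⟩
    rw [mul_assoc, Nat.mul_mod_right, hc0, ← mul_assoc, mul_comm (m * N), ← mul_assoc,
      (hwper (k * m)).eq]
  obtain ⟨w', hw', hclose⟩ := hsh (P * (m * N)) (by positivity)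
    (fun n => if P ∣ n / (m * N) + 1 then c (n % m) else (⇑T)^[n] w)
    (fun n => by
      have h1 : (n + P * (m * N)) / (m * N) + 1 = n / (m * N) + 1 + P := by
        rw [Nat.add_mul_div_right _ _ hL]
        ring
      have h2 : (n + P * (m * N)) % m = n % m := by
        rw [mul_left_comm, Nat.add_mul_mod_self_left]
      simp only [h1, h2, hiter, Nat.dvd_add_self_right])
    (fun n => by
      have horbit : T ((⇑T)^[n] w) = (⇑T)^[n + 1] w := (Function.iterate_succ_apply' _ _ _).symm
      by_cases hdvd : m * N ∣ n + 1
      · have hnext := hswitch (n + 1) hdvd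
        simp only [← hnext, ite_self]
        split_ifs
        · exact hloop n
        · rw [horbit, hnext, sub_self, norm_zero]
          exact hδ.le
      · simp only [Nat.succ_div_of_not_dvd hdvd]
        split_ifs
        · exact hloop n
        · rw [horbit, sub_self, norm_zero]
          exact hδ.le)
  refine ⟨w', m * N, (P - 1) * (m * N) + j, hL, Dvd.intro_left m rfl, hw', fun n hn => ?_,
    fun k => ?_⟩
  · simpa only [if_neg hn] using hclose n
  · have hjL : j < m * N := hjm.trans_le (Nat.le_mul_of_pos_right m hN)
    have h0 : (P - 1) * (m * N) + j + k * (P * (m * N)) = j + (P - 1 + k * P) * (m * N) := by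
      ring
    have h1 : (j + (P - 1 + k * P) * (m * N)) / (m * N) + 1 = P * (k + 1) := by
      rw [Nat.add_mul_div_right _ _ hL, Nat.div_eq_of_lt hjL, mul_add, mul_comm k P]
      omega
    have h2 : (j + (P - 1 + k * P) * (m * N)) % m = j := by
      rw [mul_left_comm, Nat.add_mul_mod_self_left, Nat.mod_eq_of_lt hjm]
    have := hclose (j + (P - 1 + k * P) * (m * N))
    rw [h1, h2, if_pos (Dvd.intro _ rfl), hcj] at this
    rwa [h0]

end Shadowing

/-- A chain transitive operator with the positive shadowing property on a separable
Banach space is frequently hypercyclic. -/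
theorem stmt_15 {𝕜 : Type*} [RCLike 𝕜] {X : Type*} [NormedAddCommGroup X]
    [NormedSpace 𝕜 X] [CompleteSpace X] [TopologicalSpace.SeparableSpace X]
    (T : X →L[𝕜] X)
    (hct : ∀ x : X, ChainRecurrent (⇑T) x) (hsh : PosShadowing (⇑T)) :
    ∃ z : X, ∀ V : Set X, IsOpen V → V.Nonempty →
      0 < lowerDensity {n : ℕ | (⇑T)^[n] z ∈ V} := by
  let y : ℕ → X := fun i => TopologicalSpace.denseSeq X i.unpair.1
  have hstep : ∀ (i : ℕ) (s : {s : X × ℕ // 0 < s.2 ∧ (⇑T)^[s.2] s.1 = s.1}),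
      ∃ s' : {s : X × ℕ // 0 < s.2 ∧ (⇑T)^[s.2] s.1 = s.1}, s.1.2 ≤ s'.1.2 ∧
        ∃ L t : ℕ, 0 < L ∧
          (∀ n, ¬ 8 * 2 ^ i * s.1.2 ∣ n / L + 1 →
            ‖(⇑T)^[n] s.1.1 - (⇑T)^[n] s'.1.1‖ ≤ 1 / 2 / 2 ^ i) ∧
          ∀ k, ‖y i - (⇑T)^[t + k * s'.1.2] s'.1.1‖ ≤ 1 / 2 / 2 ^ i := by
    rintro i ⟨⟨w, N⟩, hN, hw⟩
    have hP : 8 ≤ 8 * 2 ^ i * N := by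
      have : 0 < 2 ^ i * N := by positivity
      nlinarith
    obtain ⟨w', L, t, hL, hNL, hw', hclose, hvisit⟩ := exists_periodic_visiting hct hsh hN hw (y i)
      (show (0 : ℝ) < 1 / 2 / 2 ^ i by positivity) (show 2 ≤ 8 * 2 ^ i * N by omega)
    refine ⟨⟨(w', 8 * 2 ^ i * N * L), by positivity, hw'⟩, ?_, L, t, hL, hclose, hvisit⟩
    exact (Nat.le_of_dvd hL hNL).trans (Nat.le_mul_of_pos_left L (by omega))
  choose F hmono L t hL hclose hvisit using hstep
  let s : ℕ → {s : X × ℕ // 0 < s.2 ∧ (⇑T)^[s.2] s.1 = s.1} := fun i =>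
    Nat.rec ⟨(0, 1), one_pos, by simp⟩ (fun i s => F i s) i
  have hNmono : Monotone fun i => (s i).1.2 := monotone_nat_of_le_succ fun i => hmono i (s i)
  have hclose' : ∀ i n, ¬ 8 * 2 ^ i * (s i).1.2 ∣ n / L i (s i) + 1 →
      dist ((⇑T)^[n] (s i).1.1) ((⇑T)^[n] (s (i + 1)).1.1) ≤ 1 / 2 / 2 ^ i := fun i n h => by
    rw [dist_eq_norm]
    exact hclose i (s i) n h
  have hcauchy : CauchySeq fun i => (s i).1.1 := by
    refine cauchySeq_of_le_geometric_two (C := 1) fun i => hclose' i 0 ?_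
    have hpos : 0 < 2 ^ i * (s i).1.2 := Nat.mul_pos (by positivity) (s i).2.1
    rw [Nat.zero_div, zero_add, Nat.dvd_one, mul_assoc]
    omega
  obtain ⟨z, hz⟩ := cauchySeq_tendsto_of_complete hcauchy
  refine ⟨z, fun V hV ⟨v, hv⟩ => ?_⟩
  obtain ⟨l, hl⟩ := (TopologicalSpace.denseRange_denseSeq X).exists_mem_open hV ⟨v, hv⟩
  obtain ⟨r, hr, hball⟩ := Metric.isOpen_iff.1 hV _ hl
  obtain ⟨q, hq⟩ := exists_pow_lt_of_lt_one hr (show (1 / 2 : ℝ) < 1 by norm_num)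
  let j := Nat.pair l q
  have hyj : y j = TopologicalSpace.denseSeq X l := by simp [y, j]
  have hj : 1 / 2 ^ j < r := by
    refine lt_of_le_of_lt ?_ hq
    rw [one_div_pow]
    exact one_div_le_one_div_of_le (by positivity)
      (pow_le_pow_right₀ one_le_two (Nat.right_le_pair l q))
  refine lowerDensity_pos_of_progression_diff (s (j + 1)).2.1 (t j (s j))
    (P := fun i => 8 * 2 ^ (j + 1 + i) * (s (j + 1 + i)).1.2)
    (L := fun i => L (j + 1 + i) (s (j + 1 + i))) (fun i => ?_) (fun i => hL _ _) ?_
  · exact Nat.mul_le_mul (Nat.mul_le_mul_left 8 (Nat.pow_le_pow_right two_pos (by omega)))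
      (hNmono (Nat.le_add_right (j + 1) i))
  · rintro n ⟨k, hk⟩ hn
    refine hball ?_
    have h1 : dist ((⇑T)^[n] (s (j + 1)).1.1) ((⇑T)^[n] z) ≤ 1 / 2 ^ (j + 1) := by
      refine dist_le_of_le_geometric_two_of_tendsto₀ (C := 1 / 2 ^ (j + 1))
        (f := fun i => (⇑T)^[n] (s (j + 1 + i)).1.1) (fun i => ?_)
        (((T.continuous.iterate n).tendsto z).comp
          (hz.comp (tendsto_atTop_mono (fun i => Nat.le_add_left i (j + 1)) tendsto_id)))
      refine (hclose' (j + 1 + i) n (hn i)).trans (le_of_eq ?_)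
      rw [pow_add]
      field_simp
    have h2 : dist (y j) ((⇑T)^[n] (s (j + 1)).1.1) ≤ 1 / 2 / 2 ^ j := by
      rw [dist_eq_norm, hk]
      exact hvisit j (s j) k
    have h3 := dist_triangle (y j) ((⇑T)^[n] (s (j + 1)).1.1) ((⇑T)^[n] z)
    have h4 : (1 : ℝ) / 2 / 2 ^ j + 1 / 2 ^ (j + 1) = 1 / 2 ^ j := by
      rw [pow_succ]
      field_simp
      norm_num
    rw [Metric.mem_ball, dist_comm, ← hyj]
    linarith
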